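/- Let C be a linear code of length n over R such that C and C^⊥ have the same Lee weight distribution (i.e. for every integer w, the number of codewords of Lee weight w in C equals the number in C^⊥). Then the Gray image Ψ(C) is a formally self-dual code of length 3n over F_q: Ψ(C) and Ψ(C)^⊥ have the same Hamming weight distribution. -/

import Mathlib

open Polynomial

/-- The ring `R = F_q[v]/(v³ - v)`, where `v` is the image of `X`. -/
abbrev Rv (F : Type) [Field F] : Type := AdjoinRoot (X ^ 3 - X : F[X])

lemma monicV (F : Type) [Field F] : (X ^ 3 - X : F[X]).Monic :=
  Polynomial.monic_X_pow_sub (by simp)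

/-- The `i`-th coefficient of the canonical representation `a₀ + a₁ v + a₂ v²`
of an element of `R`. -/
noncomputable def coefR (F : Type) [Field F] (i : ℕ) (x : Rv F) : F :=
  (AdjoinRoot.modByMonicHom (monicV F) x).coeff i

/-- The Gray map `Ψ : Rⁿ → F_q^{3n}`, sending each coordinate
`a₀ + a₁ v + a₂ v²` to the triple `(a₀, a₀ + a₂, a₁)`. -/
noncomputable def gray (F : Type) [Field F] {n : ℕ} (x : Fin n → Rv F) :
    Fin n × Fin 3 → F :=
  fun p => ![coefR F 0 (x p.1), coefR F 0 (x p.1) + coefR F 2 (x p.1), coefR F 1 (x p.1)] p.2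

/-- The dual of a code with respect to the Euclidean inner product `x·y = Σᵢ xᵢ yᵢ`. -/
def dualSet {A : Type} [CommRing A] {ι : Type} [Fintype ι] (C : Set (ι → A)) :
    Set (ι → A) :=
  {x | ∀ c ∈ C, ∑ i, x i * c i = 0}

/-- Hamming weight: the number of nonzero coordinates. -/
noncomputable def hWt {A : Type} [Zero A] {ι : Type} [Fintype ι] (x : ι → A) : ℕ :=
  Nat.card {i // x i ≠ 0}

/-- Lee weight: the Hamming weight of the Gray image. -/
noncomputable def leeWt (F : Type) [Field F] {n : ℕ} (x : Fin n → Rv F) : ℕ :=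
  hWt (gray F x)

/-- The cyclic (right) shift `(c₀, …, c_{n-1}) ↦ (c_{n-1}, c₀, …, c_{n-2})`. -/
def rshift {A : Type} {n : ℕ} (x : Fin n → A) : Fin n → A :=
  fun i => x ((finRotate n).symm i)

/-- A code is cyclic if it is closed under the cyclic shift. -/
def IsCyclicCode {A : Type} {n : ℕ} (C : Set (Fin n → A)) : Prop :=
  ∀ x ∈ C, rshift x ∈ C

/-- The element `a + b v + c v²` of `R`. -/
noncomputable def elemR (F : Type) [Field F] (a b c : F) : Rv F :=
  AdjoinRoot.mk _ (C a + C b * X + C c * X ^ 2)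

lemma coefR_mk_of_degree_lt (F : Type) [Field F] (i : ℕ) (p : F[X]) (hp : p.degree < 3) :
    coefR F i (AdjoinRoot.mk _ p) = p.coeff i := by
  have hd : (X ^ 3 - X : F[X]).degree = 3 := by
    compute_degree!
  rw [coefR, AdjoinRoot.modByMonicHom_mk,
    (Polynomial.modByMonic_eq_self_iff (monicV F)).2 (by rwa [hd])]

lemma degree_quadratic_lt_three {F : Type} [Field F] (a b c : F) :
    (C a + C b * X + C c * X ^ 2 : F[X]).degree < 3 := by
  refine lt_of_le_of_lt (b := 2) ?_ (by norm_num)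
  compute_degree

lemma coefR_zero_elemR {F : Type} [Field F] (a b c : F) : coefR F 0 (elemR F a b c) = a := by
  rw [elemR, coefR_mk_of_degree_lt _ _ _ (degree_quadratic_lt_three a b c)]
  simp

lemma coefR_one_elemR {F : Type} [Field F] (a b c : F) : coefR F 1 (elemR F a b c) = b := by
  rw [elemR, coefR_mk_of_degree_lt _ _ _ (degree_quadratic_lt_three a b c)]
  simp [coeff_C, coeff_X_pow]

lemma coefR_two_elemR {F : Type} [Field F] (a b c : F) : coefR F 2 (elemR F a b c) = c := by
  rw [elemR, coefR_mk_of_degree_lt _ _ _ (degree_quadratic_lt_three a b c)]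
  simp

lemma elemR_coefR {F : Type} [Field F] (x : Rv F) :
    elemR F (coefR F 0 x) (coefR F 1 x) (coefR F 2 x) = x := by
  have hd : (X ^ 3 - X : F[X]).natDegree = 3 := by compute_degree!
  conv_rhs => rw [← AdjoinRoot.mk_leftInverse (monicV F) x]
  rw [elemR]
  congr 1
  have hlt : (AdjoinRoot.modByMonicHom (monicV F) x).natDegree < 3 := by
    induction x using AdjoinRoot.induction_on with
    | ih p =>
      rw [AdjoinRoot.modByMonicHom_mk]
      refine lt_of_lt_of_eq (Polynomial.natDegree_modByMonic_lt p (monicV F) fun h => ?_) hd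
      simp [h] at hd
  conv_rhs => rw [Polynomial.as_sum_range_C_mul_X_pow'
    (AdjoinRoot.modByMonicHom (monicV F) x) hlt]
  simp [Finset.sum_range_succ, coefR]

lemma elemR_mul {F : Type} [Field F] (a b c a' b' c' : F) :
    elemR F a b c * elemR F a' b' c' =
      elemR F (a * a') (a * b' + b * a' + b * c' + c * b')
        (a * c' + b * b' + c * a' + c * c') := by
  rw [elemR, elemR, elemR, ← map_mul, AdjoinRoot.mk_eq_mk]
  refine ⟨C (b * c' + c * b') + C (c * c') * X, ?_⟩
  simp only [C_add, C_mul]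
  ring

/-- The linear functional `a + b v + c v² ↦ 2 a + c`, whose value on a product is the inner
product of the Gray images. -/
noncomputable def grayFunctional (F : Type) [Field F] : Rv F →+ F where
  toFun x := 2 * coefR F 0 x + coefR F 2 x
  map_zero' := by simp [coefR]
  map_add' x y := by simp only [coefR, map_add, coeff_add]; ring

lemma grayFunctional_mul {F : Type} [Field F] (x y : Rv F) :
    grayFunctional F (x * y) = coefR F 0 x * coefR F 0 y +
      (coefR F 0 x + coefR F 2 x) * (coefR F 0 y + coefR F 2 y) +
      coefR F 1 x * coefR F 1 y := by
  have hxy := elemR_mul (coefR F 0 x) (coefR F 1 x) (coefR F 2 x)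
    (coefR F 0 y) (coefR F 1 y) (coefR F 2 y)
  rw [elemR_coefR, elemR_coefR] at hxy
  rw [hxy]
  change 2 * coefR F 0 _ + coefR F 2 _ = _
  rw [coefR_zero_elemR, coefR_two_elemR]
  ring

lemma sum_gray_mul_gray {F : Type} [Field F] {n : ℕ} (x y : Fin n → Rv F) :
    ∑ p, gray F x p * gray F y p = grayFunctional F (∑ i, x i * y i) := by
  rw [map_sum, Fintype.sum_prod_type]
  refine Finset.sum_congr rfl fun i _ => ?_
  rw [grayFunctional_mul, Fin.sum_univ_three]
  simp [gray]

lemma eq_zero_of_grayFunctional_mul_eq_zero {F : Type} [Field F] (s : Rv F)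
    (hs : ∀ r, grayFunctional F (r * s) = 0) : s = 0 := by
  have h₁ := hs (elemR F 1 0 (-1))
  have h₂ := hs (elemR F 0 0 1)
  have h₃ := hs (elemR F 0 1 0)
  simp only [grayFunctional_mul, coefR_zero_elemR, coefR_one_elemR, coefR_two_elemR] at h₁ h₂ h₃
  have e₀ : coefR F 0 s = 0 := by linear_combination h₁
  have e₁ : coefR F 1 s = 0 := by linear_combination h₃
  have e₂ : coefR F 2 s = 0 := by linear_combination h₂ - h₁
  rw [← elemR_coefR s, e₀, e₁, e₂]
  simp [elemR]

lemma gray_injective {F : Type} [Field F] {n : ℕ} :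
    Function.Injective (gray F : (Fin n → Rv F) → _) := by
  intro x y hxy
  funext i
  have h₀ := congrFun hxy (i, 0)
  have h₁ := congrFun hxy (i, 1)
  have h₂ := congrFun hxy (i, 2)
  simp only [gray, Matrix.cons_val] at h₀ h₁ h₂
  rw [h₀, add_right_inj] at h₁
  rw [← elemR_coefR (x i), ← elemR_coefR (y i), h₀, h₁, h₂]

lemma gray_surjective {F : Type} [Field F] {n : ℕ} :
    Function.Surjective (gray F : (Fin n → Rv F) → _) := by
  intro y
  refine ⟨fun i => elemR F (y (i, 0)) (y (i, 2)) (y (i, 1) - y (i, 0)), ?_⟩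
  funext ⟨i, j⟩
  fin_cases j <;> simp [gray, coefR_zero_elemR, coefR_one_elemR, coefR_two_elemR]

/-- The Gray map commutes with taking duals of linear codes. -/
lemma dualSet_gray_image {F : Type} [Field F] {n : ℕ} (C : Submodule (Rv F) (Fin n → Rv F)) :
    dualSet (gray F '' (C : Set (Fin n → Rv F))) =
      gray F '' dualSet (C : Set (Fin n → Rv F)) := by
  ext y
  constructor
  · intro hy
    obtain ⟨x, rfl⟩ := gray_surjective y
    refine ⟨x, fun c hc => eq_zero_of_grayFunctional_mul_eq_zero _ fun r => ?_, rfl⟩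
    have hr := hy _ ⟨r • c, C.smul_mem r hc, rfl⟩
    rw [sum_gray_mul_gray] at hr
    rw [← hr, Finset.mul_sum]
    congr 1
    refine Finset.sum_congr rfl fun i _ => ?_
    rw [Pi.smul_apply, smul_eq_mul]
    ring
  · rintro ⟨x, hx, rfl⟩ _ ⟨c, hc, rfl⟩
    rw [sum_gray_mul_gray, hx c hc, map_zero]

lemma card_gray_image_weight {F : Type} [Field F] {n : ℕ} (S : Set (Fin n → Rv F)) (w : ℕ) :
    Nat.card {y : Fin n × Fin 3 → F // y ∈ gray F '' S ∧ hWt y = w} =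
      Nat.card {x : Fin n → Rv F // x ∈ S ∧ leeWt F x = w} := by
  refine (Nat.card_congr ((Equiv.ofBijective _ ⟨gray_injective, gray_surjective⟩).subtypeEquiv
    fun x => ?_)).symm
  change _ ↔ gray F x ∈ gray F '' S ∧ hWt (gray F x) = w
  rw [gray_injective.mem_set_image, leeWt]

/-- if a linear code `C ⊆ Rⁿ` has the same Lee weight distribution as its
dual, then its Gray image `Ψ(C)` is a formally self-dual code of length `3n` over `F_q`,
i.e. `Ψ(C)` and `Ψ(C)^⊥` have the same Hamming weight distribution. -/
theorem gray_image_formally_self_dual (F : Type) [Field F] [Finite F] (n : ℕ)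
    (C : Submodule (Rv F) (Fin n → Rv F))
    (h : ∀ w : ℕ,
      Nat.card {x : Fin n → Rv F // x ∈ C ∧ leeWt F x = w} =
        Nat.card {x : Fin n → Rv F //
          x ∈ dualSet (C : Set (Fin n → Rv F)) ∧ leeWt F x = w}) :
    ∀ w : ℕ,
      Nat.card {y : Fin n × Fin 3 → F //
          y ∈ gray F '' (C : Set (Fin n → Rv F)) ∧ hWt y = w} =
        Nat.card {y : Fin n × Fin 3 → F //
          y ∈ dualSet (gray F '' (C : Set (Fin n → Rv F))) ∧ hWt y = w} := by
  intro w
  rw [dualSet_gray_image, card_gray_image_weight, card_gray_image_weight]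
  exact h w
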